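/- arXiv:0811.3833 — 4 statements merged into one kernel-verified Lean document; each statement's English description precedes it below -/
import Mathlib

section
/- Let K be a field, (L,ρ) a partial character on ℤ^m with L nonzero and positive, and σ_L = pos_ℚ(A) the rational polyhedral cone associated to I_{L,ρ}. Let B = {G₁,…,G_q} ⊆ I_{L,ρ} be a set of A-homogeneous polynomials. Then rad(I_{L,ρ}) equals the radical of the ideal generated by B if and only if for every face F of σ_L the set B ∩ K[𝔼_F] generates rad(I_{L_F,ρ}) up to radical, where I_{L_F,ρ} = I_{L,ρ} ∩ K[𝔼_F]. -/
open MvPolynomial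

namespace LatticePaper

variable {m n : ℕ}

/-- The positive part `u₊` of an integer vector, as an exponent vector. -/
noncomputable def pp (u : Fin m → ℤ) : Fin m →₀ ℕ :=
  Finsupp.equivFunOnFinite.symm fun i => (u i).toNat

/-- The negative part `u₋` of an integer vector, as an exponent vector. -/
noncomputable def np (u : Fin m → ℤ) : Fin m →₀ ℕ :=
  Finsupp.equivFunOnFinite.symm fun i => (-u i).toNat

/-- The positive part `u₊` as an integer vector. -/
def ppz (u : Fin m → ℤ) : Fin m → ℤ := fun i => max (u i) 0

/-- The negative part `u₋` as an integer vector. -/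
def npz (u : Fin m → ℤ) : Fin m → ℤ := fun i => max (-u i) 0

/-- `ℤ^E`, the subgroup of vectors supported on `E`. -/
def ZE (E : Set (Fin m)) : AddSubgroup (Fin m → ℤ) where
  carrier := {u | ∀ i, i ∉ E → u i = 0}
  add_mem' := by intro a b ha hb i hi; simp [ha i hi, hb i hi]
  zero_mem' := by intro i _; rfl
  neg_mem' := by intro a ha i hi; simp [ha i hi]

/-- `L` is a positive lattice: `L ∩ ℕ^m = {0}`. -/
def IsPositive (L : AddSubgroup (Fin m → ℤ)) : Prop :=
  ∀ u ∈ L, (∀ i, 0 ≤ u i) → u = 0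

/-- The binomial `B(u) = x^{u₊} - ρ(u) x^{u₋}` attached to a partial character `ρ` on `L`. -/
noncomputable def Bpoly (K : Type*) [Field K] {L : AddSubgroup (Fin m → ℤ)}
    (ρ : AddChar L Kˣ) (u : L) : MvPolynomial (Fin m) K :=
  monomial (pp (u : Fin m → ℤ)) (1 : K) - monomial (np (u : Fin m → ℤ)) ((ρ u : Kˣ) : K)

/-- The ideal generated by the binomials `B(u)` for `u ∈ L` with `u ∈ S`. -/
noncomputable def latIdealOn (K : Type*) [Field K] {L : AddSubgroup (Fin m → ℤ)}
    (ρ : AddChar L Kˣ) (S : Set (Fin m → ℤ)) : Ideal (MvPolynomial (Fin m) K) :=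
  Ideal.span {f | ∃ u : L, (u : Fin m → ℤ) ∈ S ∧ f = Bpoly K ρ u}

/-- The lattice ideal `I_{L,ρ}`. -/
noncomputable def latIdeal (K : Type*) [Field K] {L : AddSubgroup (Fin m → ℤ)}
    (ρ : AddChar L Kˣ) : Ideal (MvPolynomial (Fin m) K) :=
  latIdealOn K ρ Set.univ

/-- The configuration vectors, regarded over `ℚ`. -/
def ratA (A : Fin m → Fin n → ℤ) : Fin m → Fin n → ℚ := fun i j => (A i j : ℚ)

/-- The rational polyhedral cone `pos_ℚ(A)`. -/
def cone (A : Fin m → Fin n → ℤ) : Set (Fin n → ℚ) :=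
  {x | ∃ lam : Fin m → ℚ, (∀ i, 0 ≤ lam i) ∧ x = ∑ i, lam i • ratA A i}

/-- `F` is a face of the cone `pos_ℚ(A)`. -/
def IsFace (A : Fin m → Fin n → ℤ) (F : Set (Fin n → ℚ)) : Prop :=
  ∃ c : Fin n → ℚ, (∀ x ∈ cone A, 0 ≤ ∑ j, c j * x j) ∧
    F = cone A ∩ {x | ∑ j, c j * x j = 0}

/-- `𝔼_F = {i | a_i ∈ F}`. -/
def EF (A : Fin m → Fin n → ℤ) (F : Set (Fin n → ℚ)) : Set (Fin m) :=
  {i | ratA A i ∈ F}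

/-- `A` is the configuration of vectors associated to the lattice `L`:
the `A`-degree map `ℤ^m → ℤ^n` is surjective with kernel `Sat(L)`. -/
def IsConfig (L : AddSubgroup (Fin m → ℤ)) (A : Fin m → Fin n → ℤ) : Prop :=
  (∀ u : Fin m → ℤ, (∑ i, u i • A i) = 0 ↔ ∃ d : ℤ, d ≠ 0 ∧ d • u ∈ L) ∧
  Function.Surjective fun u : Fin m → ℤ => ∑ i, u i • A i

/-- A polynomial is `A`-homogeneous if all its monomials have the same `A`-degree. -/
def AHomog {K : Type*} [Field K] (A : Fin m → Fin n → ℤ) (f : MvPolynomial (Fin m) K) : Prop :=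
  ∀ d ∈ f.support, ∀ e ∈ f.support, (∑ i, (d i : ℤ) • A i) = ∑ i, (e i : ℤ) • A i

/-- The family of binomials `B(u i)` is a cover of `A`. -/
def IsCover {q : ℕ} (A : Fin m → Fin n → ℤ) (u : Fin q → Fin m → ℤ) : Prop :=
  ∀ E : Set (Fin m), (∀ F : Set (Fin n → ℚ), IsFace A F → E ≠ EF A F) →
    ∃ i, (ppz (u i) ∈ ZE E ∧ npz (u i) ∉ ZE E) ∨ (npz (u i) ∈ ZE E ∧ ppz (u i) ∉ ZE E)

/-- The minimal number of generators of an ideal. -/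
noncomputable def mu {R : Type*} [CommRing R] (I : Ideal R) : ℕ :=
  sInf {s : ℕ | ∃ f : Fin s → R, Ideal.span (Set.range f) = I}

/-- The arithmetical rank of an ideal. -/
noncomputable def ara {R : Type*} [CommRing R] (I : Ideal R) : ℕ :=
  sInf {s : ℕ | ∃ f : Fin s → R, (∀ i, f i ∈ I) ∧
    Ideal.radical (Ideal.span (Set.range f)) = Ideal.radical I}

/-- A binomial: a sum of (at most) two monomials. -/
def IsBinomial {K : Type*} [Field K] (f : MvPolynomial (Fin m) K) : Prop :=
  ∃ (a b : Fin m →₀ ℕ) (c d : K), f = monomial a c + monomial b d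

/-- The binomial arithmetical rank of an ideal of a polynomial ring. -/
noncomputable def bar {K : Type*} [Field K] (I : Ideal (MvPolynomial (Fin m) K)) : ℕ :=
  sInf {s : ℕ | ∃ f : Fin s → MvPolynomial (Fin m) K,
    (∀ i, f i ∈ I ∧ IsBinomial (f i)) ∧
    Ideal.radical (Ideal.span (Set.range f)) = Ideal.radical I}

/-- The rank of a sublattice of `ℤ^m`. -/
noncomputable def latRank (L : AddSubgroup (Fin m → ℤ)) : ℕ :=
  Module.finrank ℤ ↥(AddSubgroup.toIntSubmodule L)

/-- The toric ideal of a configuration `A` (trivial character). -/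
noncomputable def toricIdeal (K : Type*) [Field K] (A : Fin m → Fin n → ℤ) :
    Ideal (MvPolynomial (Fin m) K) :=
  Ideal.span {f | ∃ u : Fin m → ℤ, (∑ i, u i • A i) = 0 ∧
    f = monomial (pp u) (1 : K) - monomial (np u) 1}

/-- The lattice ideal of `L` with trivial character. -/
noncomputable def latIdeal1 (K : Type*) [Field K] (L : AddSubgroup (Fin m → ℤ)) :
    Ideal (MvPolynomial (Fin m) K) :=
  Ideal.span {f | ∃ u ∈ L, f = monomial (pp u) (1 : K) - monomial (np u) 1}

/-- A full configuration of vectors: `pos_ℚ(A)` is an `n`-dimensional simplex cone generated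
by the first `n` vectors, and the remaining vectors lie in its relative interior. -/
def IsFull (hnm : n ≤ m) (A : Fin m → Fin n → ℤ) : Prop :=
  LinearIndependent ℚ (fun i : Fin n => ratA A (Fin.castLE hnm i)) ∧
  cone A = cone (fun i : Fin n => A (Fin.castLE hnm i)) ∧
  ∀ i : Fin m, n ≤ (i : ℕ) → ∃ lam : Fin n → ℚ, (∀ k, 0 < lam k) ∧
    ratA A i = ∑ k, lam k • ratA A (Fin.castLE hnm k)

end LatticePaper

namespace LatticePaper

/-- The (3,3)-Veronese configuration. -/
def veroneseA : Fin 10 → Fin 3 → ℤ :=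
  ![![3,0,0], ![0,3,0], ![0,0,3], ![2,1,0], ![1,2,0],
    ![0,2,1], ![0,1,2], ![2,0,1], ![1,0,2], ![1,1,1]]

def e1v (m q : ℕ) : Fin 4 → ℤ :=
  ![(m : ℤ) + 2 * (q : ℤ) - 3, -(m : ℤ) + 2 * (q : ℤ) + 5, -1, -1]

def e2v (m q : ℕ) : Fin 4 → ℤ :=
  ![-(m : ℤ) - 2 * (q : ℤ) + 5, (m : ℤ) - 2 * (q : ℤ) - 3, -1, -1]

def e3v (m q : ℕ) : Fin 4 → ℤ :=
  ![-(m : ℤ) - 2 * (q : ℤ) + 5, -1, (m : ℤ) - 3, -1]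

/-- The lattice `L(m)` of the examples. -/
def Lm (m q : ℕ) : AddSubgroup (Fin 4 → ℤ) :=
  AddSubgroup.closure {e1v m q, e2v m q, e3v m q}

noncomputable def fpoly1 (K : Type*) [Field K] (m q : ℕ) : MvPolynomial (Fin 4) K :=
  X 0 ^ (m + 2 * q - 3) - X 1 ^ (m - 2 * q - 5) * X 2 * X 3

noncomputable def fpoly2 (K : Type*) [Field K] (m q : ℕ) : MvPolynomial (Fin 4) K :=
  X 1 ^ (m - 2 * q - 3) - X 0 ^ (m + 2 * q - 5) * X 2 * X 3

noncomputable def fpoly3 (K : Type*) [Field K] (m q : ℕ) : MvPolynomial (Fin 4) K :=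
  X 2 ^ (m - 3) - X 0 ^ (m + 2 * q - 5) * X 1 * X 3

noncomputable def fpoly123 (K : Type*) [Field K] (m : ℕ) : MvPolynomial (Fin 4) K :=
  if Even m then X 3 ^ (m - 3) - X 0 * X 1 ^ (m - 5) * X 2
  else X 3 ^ (m - 3) - X 0 ^ (m - 3) * X 1 * X 2

end LatticePaper

namespace LatticePaper

/-- If one monomial of an `A`-homogeneous polynomial lies in `K[E_F]`, all do. -/
theorem face_aux {m n : ℕ} (A : Fin m → Fin n → ℤ) (F : Set (Fin n → ℚ)) (hF : IsFace A F)
    (d e : Fin m →₀ ℕ) (hde : (∑ i, (d i : ℤ) • A i) = ∑ i, (e i : ℤ) • A i)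
    (hd : ∀ i, d i ≠ 0 → i ∈ EF A F) : ∀ i, e i ≠ 0 → i ∈ EF A F := by
  obtain ⟨c, hc, rfl⟩ := hF
  have hcone : ∀ i, ratA A i ∈ cone A := by
    intro i
    refine ⟨Pi.single i 1, ?_, ?_⟩
    · intro j
      by_cases h : j = i
      · subst h; simp
      · simp [h]
    · simp [Pi.single_apply]
  set w : Fin m → ℚ := fun i => ∑ j, c j * ratA A i j with hw
  have hw0 : ∀ i, 0 ≤ w i := fun i => hc _ (hcone i)
  have hE : ∀ i, i ∈ EF A (cone A ∩ {x | ∑ j, c j * x j = 0}) ↔ w i = 0 := by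
    intro i
    simp [EF, hcone i, hw]
  have key : ∀ d : Fin m →₀ ℕ, ∑ i, (d i : ℚ) * w i
      = ∑ j, c j * (((∑ i, (d i : ℤ) • A i) j : ℤ) : ℚ) := by
    intro d
    simp only [hw, ratA, Finset.mul_sum, Finset.sum_apply, Pi.smul_apply, smul_eq_mul]
    rw [Finset.sum_comm]
    refine Finset.sum_congr rfl fun j _ => ?_
    push_cast
    rw [Finset.mul_sum]
    exact Finset.sum_congr rfl fun i _ => by ring
  have h1 : ∑ i, (e i : ℚ) * w i = 0 := by
    rw [key, ← hde, ← key]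
    refine Finset.sum_eq_zero fun i _ => ?_
    by_cases h : d i = 0
    · simp [h]
    · rw [(hE i).1 (hd i h), mul_zero]
  intro i hi
  rw [hE]
  have h2 := (Finset.sum_eq_zero_iff_of_nonneg
    (fun i _ => mul_nonneg (Nat.cast_nonneg (e i)) (hw0 i))).1 h1 i (Finset.mem_univ i)
  rcases mul_eq_zero.1 h2 with h | h
  · exact absurd (by exact_mod_cast h) hi
  · exact h

open Classical in
/-- The retraction `K[x] → K[E]` killing the variables outside `E`. -/
noncomputable def retr (K : Type*) [Field K] {m : ℕ} (E : Set (Fin m)) :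
    MvPolynomial (Fin m) K →ₐ[K] ↥(MvPolynomial.supported K E) :=
  aeval fun i => if h : i ∈ E then ⟨X i, X_mem_supported.2 h⟩ else 0

theorem retr_val (K : Type*) [Field K] {m : ℕ} (E : Set (Fin m))
    (f : ↥(MvPolynomial.supported K E)) : retr K E (f : MvPolynomial (Fin m) K) = f := by
  apply Subtype.ext
  have h : (((MvPolynomial.supported K E).val.comp (retr K E) :
      MvPolynomial (Fin m) K →ₐ[K] MvPolynomial (Fin m) K) : _ →+* _) (f : MvPolynomial (Fin m) K)
      = (RingHom.id _) (f : MvPolynomial (Fin m) K) := by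
    refine MvPolynomial.hom_congr_vars ?_ ?_ rfl
    · ext a; simp
    · intro i hi _
      have : i ∈ E := mem_supported.1 f.2 hi
      simp [retr, this]
  exact h

theorem retr_zero (K : Type*) [Field K] {m : ℕ} (E : Set (Fin m)) (f : MvPolynomial (Fin m) K)
    (h : ∀ d ∈ f.support, ∃ i, d i ≠ 0 ∧ i ∉ E) : retr K E f = 0 := by
  refine MvPolynomial.aeval_eq_zero _ _ fun d hd => ?_
  obtain ⟨i, hi, hiE⟩ := h d (mem_support_iff.2 hd)
  exact ⟨i, Finsupp.mem_support_iff.2 hi, by simp [hiE]⟩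

/-- a set of `A`-homogeneous polynomials of `I_{L,ρ}` generates its radical up to
radical iff for every face `F` the part of it lying in `K[𝔼_F]` generates `rad I_{L_F,ρ}`
up to radical (inside the subalgebra `K[𝔼_F]`). -/
theorem statement1 {K : Type*} [Field K] {m n : ℕ}
    (L : AddSubgroup (Fin m → ℤ)) (ρ : AddChar L Kˣ)
    (hL : L ≠ ⊥) (hpos : IsPositive L)
    (A : Fin m → Fin n → ℤ) (hA : IsConfig L A)
    (B : Set (MvPolynomial (Fin m) K))
    (hBI : ∀ f ∈ B, f ∈ latIdeal K ρ)
    (hBhom : ∀ f ∈ B, AHomog A f) :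
    (latIdeal K ρ).radical = (Ideal.span B).radical ↔
      ∀ F : Set (Fin n → ℚ), IsFace A F →
        (Ideal.span {g : ↥(MvPolynomial.supported K (EF A F)) |
            (g : MvPolynomial (Fin m) K) ∈ B}).radical =
        (Ideal.comap (MvPolynomial.supported K (EF A F)).val (latIdeal K ρ)).radical := by
  constructor
  · intro h F hF
    apply le_antisymm
    · refine Ideal.radical_mono (Ideal.span_le.2 fun g hg => ?_)
      exact hBI _ hg
    · rw [Ideal.radical_le_radical_iff]
      intro f hf
      have hf1 : (f : MvPolynomial (Fin m) K) ∈ (Ideal.span B).radical := by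
        rw [← h]; exact Ideal.le_radical hf
      obtain ⟨k, hk⟩ := hf1
      refine ⟨k, ?_⟩
      have h2 := Ideal.mem_map_of_mem (retr K (EF A F)) hk
      rw [map_pow, retr_val, Ideal.map_span] at h2
      refine (Ideal.span_le.2 ?_) h2
      rintro _ ⟨G, hG, rfl⟩
      by_cases hz : ∀ d ∈ G.support, ∃ i, d i ≠ 0 ∧ i ∉ EF A F
      · rw [retr_zero K _ G hz]; exact Ideal.zero_mem _
      · push Not at hz
        obtain ⟨d, hd, hdE⟩ := hz
        have hs : G ∈ MvPolynomial.supported K (EF A F) := by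
          rw [mem_supported]
          intro i hi
          obtain ⟨e, he, hie⟩ := (mem_vars i).1 (Finset.mem_coe.1 hi)
          exact face_aux A F hF d e (hBhom G hG d hd e he) hdE i (Finsupp.mem_support_iff.1 hie)
        have h3 := retr_val K (EF A F) ⟨G, hs⟩
        simp only at h3
        rw [h3]
        exact Ideal.subset_span hG
  · intro h
    apply le_antisymm
    · have hF : IsFace A (cone A) := ⟨0, by simp, by simp⟩
      have hEF : ∀ i, i ∈ EF A (cone A) := by
        intro i
        refine ⟨Pi.single i 1, ?_, ?_⟩
        · intro j
          by_cases h : j = i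
          · subst h; simp
          · simp [h]
        · simp [Pi.single_apply]
      rw [Ideal.radical_le_radical_iff]
      intro f hf
      have hs : f ∈ MvPolynomial.supported K (EF A (cone A)) :=
        mem_supported.2 fun i _ => hEF i
      have h1 : (⟨f, hs⟩ : ↥(MvPolynomial.supported K (EF A (cone A)))) ∈
          (Ideal.comap (MvPolynomial.supported K (EF A (cone A))).val (latIdeal K ρ)).radical :=
        Ideal.le_radical hf
      rw [← h _ hF] at h1
      obtain ⟨k, hk⟩ := h1
      refine ⟨k, ?_⟩
      have h2 := Ideal.mem_map_of_mem (MvPolynomial.supported K (EF A (cone A))).val hk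
      rw [map_pow, Ideal.map_span] at h2
      refine (Ideal.span_mono ?_) h2
      rintro _ ⟨g, hg, rfl⟩
      exact hg
    · exact Ideal.radical_mono (Ideal.span_le.2 hBI)

end LatticePaper
end

section
/- Let K be a field, (L,ρ) a partial character on ℤ^m with L nonzero and positive, and F a face of σ_L = pos_ℚ(A). For a vector u = u₊ − u₋ ∈ L, the following are equivalent: u ∈ ℤ^{𝔼_F}; u₊ ∈ ℤ^{𝔼_F}; u₋ ∈ ℤ^{𝔼_F}. -/
open MvPolynomial

namespace LatticePaper

theorem aux_sum {m : ℕ} (w : Fin m → ℚ) (hw : ∀ i, 0 ≤ w i) (u : Fin m → ℤ)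
    (hs : ∑ i, (u i : ℚ) * w i = 0) (h : ∀ i, w i ≠ 0 → max (u i) 0 = 0) :
    ∀ i, w i ≠ 0 → u i = 0 := by
  have hle : ∀ i ∈ Finset.univ, (u i : ℚ) * w i ≤ 0 := by
    intro i _
    by_cases hi : w i = 0
    · simp [hi]
    · have h1 : u i ≤ 0 := max_eq_right_iff.mp (h i hi)
      exact mul_nonpos_of_nonpos_of_nonneg (by exact_mod_cast h1) (hw i)
  intro i hi
  have h2 := (Finset.sum_eq_zero_iff_of_nonpos hle).mp hs i (Finset.mem_univ i)
  rcases mul_eq_zero.mp h2 with h3 | h3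
  · exact_mod_cast h3
  · exact absurd h3 hi

/-- for `u ∈ L` and a face `F`, membership of `u`, `u₊`, `u₋` in `ℤ^{𝔼_F}`
are all equivalent. -/
theorem statement2 {K : Type*} [Field K] {m n : ℕ}
    (L : AddSubgroup (Fin m → ℤ)) (ρ : AddChar L Kˣ)
    (hL : L ≠ ⊥) (hpos : IsPositive L)
    (A : Fin m → Fin n → ℤ) (hA : IsConfig L A)
    (F : Set (Fin n → ℚ)) (hF : IsFace A F) (u : L) :
    ((u : Fin m → ℤ) ∈ ZE (EF A F) ↔ ppz (u : Fin m → ℤ) ∈ ZE (EF A F)) ∧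
    (ppz (u : Fin m → ℤ) ∈ ZE (EF A F) ↔ npz (u : Fin m → ℤ) ∈ ZE (EF A F)) := by
  obtain ⟨u, hu⟩ := u
  obtain ⟨c, hc, rfl⟩ := hF
  have hcone : ∀ i, ratA A i ∈ cone A := by
    intro i
    refine ⟨fun k => if k = i then 1 else 0, fun k => ?_, ?_⟩
    · dsimp only
      split_ifs <;> norm_num
    · simp
  have hE : ∀ v : Fin m → ℤ,
      v ∈ ZE (EF A (cone A ∩ {x | ∑ j, c j * x j = 0})) ↔
        ∀ i, (∑ j, c j * ratA A i j) ≠ 0 → v i = 0 := by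
    intro v
    change (∀ i, ¬ (ratA A i ∈ cone A ∧ ∑ j, c j * ratA A i j = 0) → v i = 0) ↔ _
    simp only [hcone, true_and, ne_eq]
  have h0 : (∑ i, u i • A i) = 0 := (hA.1 u).mpr ⟨1, one_ne_zero, by simpa using hu⟩
  have hs : ∑ i, (u i : ℚ) * (∑ j, c j * ratA A i j) = 0 := by
    have hj : ∀ j, ∑ i, (u i : ℚ) * ratA A i j = 0 := by
      intro j
      have h1 := congrFun h0 j
      simp only [Finset.sum_apply, Pi.smul_apply, smul_eq_mul, Pi.zero_apply] at h1
      unfold ratA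
      exact_mod_cast h1
    calc ∑ i, (u i : ℚ) * (∑ j, c j * ratA A i j)
        = ∑ i, ∑ j, c j * ((u i : ℚ) * ratA A i j) := by
          refine Finset.sum_congr rfl fun i _ => ?_
          rw [Finset.mul_sum]
          exact Finset.sum_congr rfl fun j _ => by ring
      _ = ∑ j, c j * ∑ i, (u i : ℚ) * ratA A i j := by
          rw [Finset.sum_comm]
          exact Finset.sum_congr rfl fun j _ => by rw [Finset.mul_sum]
      _ = 0 := by simp [hj]
  have hw : ∀ i, 0 ≤ ∑ j, c j * ratA A i j := fun i => hc _ (hcone i)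
  have hp := aux_sum _ hw u hs
  have hn := aux_sum _ hw (-u) (by simpa using hs)
  simp only [hE, ppz, npz]
  simp only [Pi.neg_apply, neg_eq_zero] at hn
  refine ⟨⟨fun h i hi => by simp [h i hi], hp⟩, fun h i hi => by simp [hp h i hi],
    fun h i hi => by simp [hn h i hi]⟩

end LatticePaper
end

section
/- Let K be a field of characteristic zero, (L,ρ) a partial character on ℤ^m with L nonzero and positive, u₁,…,u_q elements of L, and σ_L = pos_ℚ(A) the rational polyhedral cone associated to I_{L,ρ}. Then rad(I_{L,ρ}) = rad(B(u₁),…,B(u_q)) if and only if (i) {B(u₁),…,B(u_q)} is a cover of A, and (ii) for every face F of σ_L one has L ∩ ℤ^{𝔼_F} = Σ_{u_i ∈ ℤ^{𝔼_F}} ℤu_i. -/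
open MvPolynomial

namespace LatticePaper


/-- The Farkas lemma (algebraic proof by Bartl). -/
lemma farkas {W ι : Type*} [AddCommGroup W] [Module ℚ W] (s : Finset ι) :
    ∀ (α : ι → (W →ₗ[ℚ] ℚ)) (γ : W →ₗ[ℚ] ℚ),
      (∀ x, (∀ i ∈ s, α i x ≤ 0) → γ x ≤ 0) →
      ∃ lam : ι → ℚ, (∀ i, 0 ≤ lam i) ∧ ∀ x, γ x = ∑ i ∈ s, lam i * α i x := by
  classical
  induction s using Finset.induction_on with
  | empty =>
    intro α γ h
    refine ⟨fun _ => 0, fun _ => le_rfl, fun x => ?_⟩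
    have h1 := h x (by simp)
    have h2 := h (-x) (by simp)
    rw [map_neg] at h2
    simp only [Finset.sum_empty]
    linarith
  | insert a s ha ih =>
    intro α γ h
    by_cases hs : ∀ x, (∀ i ∈ s, α i x ≤ 0) → γ x ≤ 0
    · obtain ⟨lam, hl, he⟩ := ih α γ hs
      refine ⟨fun i => if i = a then 0 else lam i, fun i => ?_, fun x => ?_⟩
      · dsimp only
        split_ifs
        · exact le_rfl
        · exact hl i
      · rw [Finset.sum_insert ha, he x]
        simp only [if_true, zero_mul, zero_add]
        refine Finset.sum_congr rfl fun i hi => ?_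
        rw [if_neg]
        rintro rfl
        exact ha hi
    · push Not at hs
      obtain ⟨y, hy, hgy⟩ := hs
      have hay : 0 < α a y := by
        by_contra hcon
        push Not at hcon
        have := h y (by
          intro i hi
          rcases Finset.mem_insert.1 hi with rfl | hi
          · exact hcon
          · exact hy i hi)
        linarith
      -- normalise
      let z : W := (α a y)⁻¹ • y
      have hz1 : α a z = 1 := by simp [z, hay.ne']
      have hzs : ∀ i ∈ s, α i z ≤ 0 := by
        intro i hi
        simp only [z, map_smul, smul_eq_mul]
        exact mul_nonpos_of_nonneg_of_nonpos (inv_nonneg.2 hay.le) (hy i hi)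
      have hzg : 0 < γ z := by
        simp only [z, map_smul, smul_eq_mul]
        exact mul_pos (inv_pos.2 hay) hgy
      let pr : (W →ₗ[ℚ] ℚ) → (W →ₗ[ℚ] ℚ) := fun f => f - (f z) • α a
      have hpr : ∀ f x, pr f x = f x - f z * α a x := fun f x => by simp [pr]
      obtain ⟨lam, hl, he⟩ := ih (fun i => pr (α i)) (pr γ) (by
        intro x hx
        have := h (x - α a x • z) (by
          intro i hi
          rcases Finset.mem_insert.1 hi with rfl | hi
          · simp [hz1]
          · have := hx i hi
            rw [hpr] at this
            simp only [map_sub, map_smul, smul_eq_mul]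
            linarith)
        rw [hpr]
        simp only [map_sub, map_smul, smul_eq_mul] at this
        linarith)
      have hco : 0 ≤ γ z - ∑ i ∈ s, lam i * α i z := by
        have : ∑ i ∈ s, lam i * α i z ≤ 0 :=
          Finset.sum_nonpos fun i hi => mul_nonpos_of_nonneg_of_nonpos (hl i) (hzs i hi)
        linarith
      refine ⟨fun i => if i = a then γ z - ∑ i ∈ s, lam i * α i z else lam i,
        fun i => ?_, fun x => ?_⟩
      · dsimp only
        split_ifs
        · exact hco
        · exact hl i
      · rw [Finset.sum_insert ha]
        have h1 : ∑ i ∈ s, (if i = a then γ z - ∑ i ∈ s, lam i * α i z else lam i) * α i x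
            = ∑ i ∈ s, lam i * α i x := by
          refine Finset.sum_congr rfl fun i hi => ?_
          rw [if_neg]
          rintro rfl
          exact ha hi
        rw [h1]
        dsimp only
        rw [if_pos rfl]
        have h2 := he x
        simp only [hpr] at h2
        have h3 : ∑ i ∈ s, lam i * (α i x - α i z * α a x)
            = ∑ i ∈ s, lam i * α i x - (∑ i ∈ s, lam i * α i z) * α a x := by
          rw [Finset.sum_mul, ← Finset.sum_sub_distrib]
          exact Finset.sum_congr rfl fun i _ => by ring
        rw [h3] at h2
        linarith

/-- the pairing `c · a_i` -/
def cdot (A : Fin m → Fin n → ℤ) (c : Fin n → ℚ) (i : Fin m) : ℚ := ∑ j, c j * ratA A i j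

lemma ratA_mem_cone (A : Fin m → Fin n → ℤ) (i : Fin m) : ratA A i ∈ cone A := by
  classical
  refine ⟨fun k => if k = i then 1 else 0, fun k => ?_, ?_⟩
  · dsimp only
    split_ifs <;> norm_num
  · simp

lemma cone_pair (A : Fin m → Fin n → ℤ) (c : Fin n → ℚ) (w : Fin m → ℚ) :
    ∑ j, c j * (∑ i, w i • ratA A i) j = ∑ i, w i * cdot A c i := by
  simp only [cdot, Finset.sum_apply, Pi.smul_apply, smul_eq_mul, Finset.mul_sum]
  rw [Finset.sum_comm]
  refine Finset.sum_congr rfl fun i _ => Finset.sum_congr rfl fun j _ => by ring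

lemma isFace_of (A : Fin m → Fin n → ℤ) (E : Set (Fin m)) (c : Fin n → ℚ)
    (h0 : ∀ i ∈ E, cdot A c i = 0) (h1 : ∀ i ∉ E, 0 < cdot A c i) :
    ∃ F, IsFace A F ∧ E = EF A F := by
  refine ⟨cone A ∩ {x | ∑ j, c j * x j = 0}, ⟨c, ?_, rfl⟩, ?_⟩
  · rintro x ⟨w, hw, rfl⟩
    rw [cone_pair]
    refine Finset.sum_nonneg fun i _ => mul_nonneg (hw i) ?_
    by_cases hi : i ∈ E
    · rw [h0 i hi]
    · exact (h1 i hi).le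
  · ext i
    refine ⟨fun hi => ⟨ratA_mem_cone A i, h0 i hi⟩, fun hi => ?_⟩
    by_contra hcon
    exact (h1 i hcon).ne' hi.2

lemma face_data (A : Fin m → Fin n → ℤ) (F) (hF : IsFace A F) :
    ∃ c : Fin n → ℚ, (∀ i, 0 ≤ cdot A c i) ∧ ∀ i, i ∈ EF A F ↔ cdot A c i = 0 := by
  obtain ⟨c, hc, rfl⟩ := hF
  exact ⟨c, fun i => hc _ (ratA_mem_cone A i), fun i =>
    ⟨fun h => h.2, fun h => ⟨ratA_mem_cone A i, h⟩⟩⟩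

lemma mem_lat_pair (L : AddSubgroup (Fin m → ℤ)) (A : Fin m → Fin n → ℤ) (hA : IsConfig L A)
    (u : Fin m → ℤ) (hu : u ∈ L) (c : Fin n → ℚ) : ∑ i, (u i : ℚ) * cdot A c i = 0 := by
  have h := (hA.1 u).2 ⟨1, one_ne_zero, by simpa using hu⟩
  rw [← cone_pair]
  have : ∀ j, (∑ i, (u i : ℚ) • ratA A i) j = 0 := by
    intro j
    have hj := congrFun h j
    simp only [Finset.sum_apply, Pi.smul_apply, smul_eq_mul, Pi.zero_apply] at hj
    simp only [Finset.sum_apply, Pi.smul_apply, smul_eq_mul, ratA]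
    exact_mod_cast hj
  simp [this]

lemma face_sym_aux (L : AddSubgroup (Fin m → ℤ)) (A : Fin m → Fin n → ℤ) (hA : IsConfig L A)
    (F) (hF : IsFace A F) (u : Fin m → ℤ) (hu : u ∈ L) (h : ∀ i ∉ EF A F, 0 ≤ u i) :
    ∀ i ∉ EF A F, u i = 0 := by
  obtain ⟨c, hc, hE⟩ := face_data A F hF
  have hs := mem_lat_pair L A hA u hu c
  have hnn : ∀ i ∈ Finset.univ, 0 ≤ (u i : ℚ) * cdot A c i := by
    intro i _
    by_cases hi : i ∈ EF A F
    · rw [(hE i).1 hi, mul_zero]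
    · exact mul_nonneg (by exact_mod_cast h i hi) (hc i)
  intro i hi
  have := (Finset.sum_eq_zero_iff_of_nonneg hnn).1 hs i (Finset.mem_univ _)
  rcases mul_eq_zero.1 this with h' | h'
  · exact_mod_cast h'
  · exact absurd ((hE i).2 h') hi

lemma face_sym (L : AddSubgroup (Fin m → ℤ)) (A : Fin m → Fin n → ℤ) (hA : IsConfig L A)
    (F) (hF : IsFace A F) (u : Fin m → ℤ) (hu : u ∈ L) :
    ((∀ i ∉ EF A F, u i ≤ 0) ↔ u ∈ ZE (EF A F)) ∧
    ((∀ i ∉ EF A F, 0 ≤ u i) ↔ u ∈ ZE (EF A F)) := by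
  refine ⟨⟨fun h i hi => ?_, fun h i hi => (h i hi).le⟩,
    ⟨fun h => face_sym_aux L A hA F hF u hu h, fun h i hi => (h i hi).ge⟩⟩
  have := face_sym_aux L A hA F hF (-u) (L.neg_mem hu)
    (fun i hi => by simpa using h i hi) i hi
  simpa using this

lemma not_face_exists (L : AddSubgroup (Fin m → ℤ)) (A : Fin m → Fin n → ℤ)
    (hA : IsConfig L A) (E : Set (Fin m)) (hE : ∀ F, IsFace A F → E ≠ EF A F) :
    ∃ u ∈ L, (∀ i ∉ E, 0 ≤ u i) ∧ ¬ (∀ i ∉ E, u i ≤ 0) := by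
  classical
  by_contra hno
  -- all functionals exist
  have key : ∀ j : Fin m, ∃ c : Fin n → ℚ, j ∉ E →
      ((∀ i, 0 ≤ cdot A c i) ∧ (∀ i ∈ E, cdot A c i = 0) ∧ 0 < cdot A c j) := by
    intro j
    by_cases hj : j ∈ E
    · exact ⟨0, fun h => absurd hj h⟩
    by_contra hc
    push Not at hc
    apply hno
    let f : Fin m → ((Fin n → ℚ) →ₗ[ℚ] ℚ) := fun i =>
      { toFun := fun c => cdot A c i
        map_add' := by intro x y; simp [cdot, add_mul, Finset.sum_add_distrib]
        map_smul' := by intro r x; simp [cdot, Finset.mul_sum, mul_assoc] }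
    obtain ⟨lam, hl, he⟩ := farkas (Finset.univ : Finset (Fin m ⊕ Fin m))
      (Sum.elim (fun k => - f k) (fun k => if k ∈ E then f k else 0)) (f j) (by
        intro c hcc
        by_contra hpos
        push Not at hpos
        obtain ⟨-, h2⟩ := hc c
        have h0 : ∀ i, 0 ≤ cdot A c i := fun i => by
          have : -(cdot A c i) ≤ 0 := hcc (Sum.inl i) (Finset.mem_univ _)
          linarith
        have := h2 h0 (fun i hi => le_antisymm (by
          have := hcc (Sum.inr i) (Finset.mem_univ _)
          simp only [Sum.elim_inr, if_pos hi] at this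
          exact this) (h0 i))
        have hp : 0 < cdot A c j := hpos
        linarith)
    let w : Fin m → ℚ := fun i =>
      (if i = j then 1 else 0) + lam (Sum.inl i) - (if i ∈ E then lam (Sum.inr i) else 0)
    have hw : ∀ c, ∑ i, w i * cdot A c i = 0 := by
      intro c
      have := he c
      rw [Fintype.sum_sum_type] at this
      have e1 : ∀ i, f i c = cdot A c i := fun i => rfl
      simp only [Sum.elim_inl, Sum.elim_inr, LinearMap.neg_apply, e1] at this
      have e2 : ∀ i, w i * cdot A c i = (if i = j then cdot A c i else 0)
          - lam (Sum.inl i) * (- cdot A c i)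
          - lam (Sum.inr i) * ((if i ∈ E then f i else 0 : (Fin n → ℚ) →ₗ[ℚ] ℚ) c) := by
        intro i
        simp only [w]
        split_ifs <;> simp [e1] <;> ring
      rw [Finset.sum_congr rfl (fun i _ => e2 i), Finset.sum_sub_distrib,
        Finset.sum_sub_distrib, Finset.sum_ite_eq' Finset.univ j]
      simp only [Finset.mem_univ, if_true]
      linarith
    obtain ⟨b, hb⟩ := IsLocalization.exist_integer_multiples_of_finite
      (nonZeroDivisors ℤ) w
    choose v hv using hb
    have hb0 : (b : ℤ) ≠ 0 := nonZeroDivisors.coe_ne_zero b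
    have hv' : ∀ i, (v i : ℚ) = ((b : ℤ) : ℚ) * w i := by
      intro i
      have := hv i
      simpa using this
    have hker : ∑ i, v i • A i = 0 := by
      funext k
      have := hw (Pi.single k 1)
      have e3 : ∀ i, cdot A (Pi.single k 1) i = (A i k : ℚ) := by
        intro i
        simp [cdot, Pi.single_apply, ratA]
      simp only [e3] at this
      have h4 : ∑ i, (v i : ℚ) * (A i k : ℚ) = 0 := by
        simp only [hv', mul_assoc]
        rw [← Finset.mul_sum, this, mul_zero]
      simp only [Finset.sum_apply, Pi.smul_apply, smul_eq_mul, Pi.zero_apply]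
      exact_mod_cast h4
    obtain ⟨d, hd0, hd⟩ := (hA.1 v).1 hker
    have hsgn : ∀ i, (((d * d * b * v i : ℤ)) : ℚ) = (((d * b) ^ 2 : ℤ) : ℚ) * w i := by
      intro i
      push_cast
      rw [hv']
      ring
    have hpos2 : (0 : ℚ) < (((d * b) ^ 2 : ℤ) : ℚ) := by
      have : d * b ≠ 0 := mul_ne_zero hd0 hb0
      have : 0 < (d * b) ^ 2 := by positivity
      exact_mod_cast this
    have hwn : ∀ i ∉ E, 0 ≤ w i := by
      intro i hi
      simp only [w, if_neg hi, sub_zero]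
      have := hl (Sum.inl i)
      split_ifs <;> linarith
    have hwj : 0 < w j := by
      simp only [w, if_neg hj, sub_zero, if_true]
      have := hl (Sum.inl j)
      linarith
    refine ⟨(d * b) • (d • v), L.zsmul_mem hd _, ?_, ?_⟩
    · intro i hi
      have : (0 : ℚ) ≤ ((d * d * b * v i : ℤ) : ℚ) := by
        rw [hsgn]
        exact mul_nonneg hpos2.le (hwn i hi)
      have h5 : 0 ≤ d * d * b * v i := by exact_mod_cast this
      simp only [Pi.smul_apply, smul_eq_mul]
      linarith
    · intro hall
      have := hall j hj
      have h6 : (0 : ℚ) < ((d * d * b * v j : ℤ) : ℚ) := by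
        rw [hsgn]
        exact mul_pos hpos2 hwj
      have h5 : 0 < d * d * b * v j := by exact_mod_cast h6
      simp only [Pi.smul_apply, smul_eq_mul] at this
      linarith
  choose c hc using key
  have hsum : ∀ i, cdot A (∑ j with j ∉ E, c j) i = ∑ j with j ∉ E, cdot A (c j) i := by
    intro i
    simp only [cdot, Finset.sum_apply, Finset.sum_mul]
    rw [Finset.sum_comm]
  obtain ⟨F, hF, hEF⟩ := isFace_of A E (∑ j with j ∉ E, c j)
    (by
      intro i hi
      rw [hsum]
      refine Finset.sum_eq_zero fun j hj => ?_
      exact (hc j (Finset.mem_filter.1 hj).2).2.1 i hi)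
    (by
      intro i hi
      rw [hsum]
      refine Finset.sum_pos' (fun j hj => (hc j (Finset.mem_filter.1 hj).2).1 i)
        ⟨i, by simp [hi], (hc i hi).2.2⟩)
  exact hE F hF hEF


section chars

variable (Ω : Type*) [Field Ω] [IsAlgClosed Ω]

lemma baer_units : Module.Baer ℤ (Additive Ωˣ) := by
  have hN : ∀ {n : ℕ}, n ≠ 0 → Function.Surjective (fun a : Additive Ωˣ => n • a) := by
    intro n hn a
    obtain ⟨z, hz⟩ := IsAlgClosed.exists_pow_nat_eq ((Additive.toMul a : Ωˣ) : Ω)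
      (Nat.pos_of_ne_zero hn)
    have hz0 : z ≠ 0 := by
      rintro rfl
      rw [zero_pow hn] at hz
      exact (Additive.toMul a).ne_zero hz.symm
    refine ⟨Additive.ofMul (Units.mk0 z hz0), ?_⟩
    apply Additive.toMul.injective
    apply Units.ext
    simpa using hz
  let : DivisibleBy (Additive Ωˣ) ℕ := divisibleByOfSMulRightSurj _ _ hN
  let : DivisibleBy (Additive Ωˣ) ℤ := AddGroup.divisibleByIntOfDivisibleByNat _
  exact Module.Baer.of_divisible _

lemma char_extend {G : Type*} [AddCommGroup G] (H : AddSubgroup G) (χ : H →+ Additive Ωˣ) :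
    ∃ Y : G →+ Additive Ωˣ, ∀ h : H, Y h = χ h := by
  obtain ⟨Y, hY⟩ := (baer_units Ω).extension_property_addMonoidHom H.subtype
    H.subtype_injective χ
  exact ⟨Y, fun h => DFunLike.congr_fun hY h⟩

lemma exists_torsion [CharZero Ω] (n : ℕ) (hn : n ≠ 1) :
    ∃ g : Additive Ωˣ, g ≠ 0 ∧ (n : ℤ) • g = 0 := by
  rcases Nat.eq_zero_or_pos n with rfl | hpos
  · refine ⟨Additive.ofMul (Units.mk0 (2 : Ω) two_ne_zero), ?_, by simp⟩
    intro h
    have h2 : Units.mk0 (2 : Ω) two_ne_zero = 1 := h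
    have h3 := congrArg Units.val h2
    simp at h3
  · have : NeZero n := ⟨hpos.ne'⟩
    obtain ⟨ζ, hζ⟩ := HasEnoughRootsOfUnity.exists_primitiveRoot Ω n
    refine ⟨Additive.ofMul (Units.mk0 ζ (hζ.ne_zero hpos.ne')), ?_, ?_⟩
    · intro h
      have h2 : Units.mk0 ζ (hζ.ne_zero hpos.ne') = 1 := h
      have h3 := congrArg Units.val h2
      simp only [Units.val_mk0, Units.val_one] at h3
      subst h3
      exact hn (hζ.unique IsPrimitiveRoot.one)
    · apply Additive.toMul.injective
      apply Units.ext
      simpa using hζ.pow_eq_one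

lemma char_sep [CharZero Ω] {G : Type*} [AddCommGroup G] (v : G) (hv : v ≠ 0) :
    ∃ Y : G →+ Additive Ωˣ, Y v ≠ 0 := by
  obtain ⟨g, hg0, hg⟩ := exists_torsion Ω (addOrderOf v)
    (by rwa [Ne, AddMonoid.addOrderOf_eq_one_iff])
  let l : ℤ ⧸ Ideal.span {(addOrderOf v : ℤ)} →ₗ[ℤ] Additive Ωˣ :=
    Submodule.liftQSpanSingleton _ (LinearMap.toSpanSingleton ℤ _ g) (by
      rw [LinearMap.toSpanSingleton_apply]; exact hg)
  let f : (Submodule.span ℤ {v}) →ₗ[ℤ] Additive Ωˣ :=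
    l ∘ₗ (CharacterModule.intSpanEquivQuotAddOrderOf v).toLinearMap
  obtain ⟨Y, hY⟩ := (baer_units Ω).extension_property (Submodule.span ℤ {v}).subtype
    (Submodule.injective_subtype _) f
  refine ⟨Y.toAddMonoidHom, ?_⟩
  have h1 := LinearMap.congr_fun hY ⟨v, Submodule.mem_span_singleton_self v⟩
  have h2 : f ⟨v, Submodule.mem_span_singleton_self v⟩ = g := by
    change l (CharacterModule.intSpanEquivQuotAddOrderOf v
      ⟨v, Submodule.mem_span_singleton_self v⟩) = g
    rw [CharacterModule.intSpanEquivQuotAddOrderOf_apply_self]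
    change LinearMap.toSpanSingleton ℤ _ g 1 = g
    simp
  rw [h2] at h1
  change Y v ≠ 0
  intro h
  exact hg0 (h1.symm.trans h)

/-- Extend a character from `H` so as to avoid a prescribed value at `v ∉ H`. -/
lemma char_extend_avoid [CharZero Ω] {G : Type*} [AddCommGroup G] (H : AddSubgroup G)
    (χ : H →+ Additive Ωˣ) (v : G) (hv : v ∉ H) (r : Additive Ωˣ) :
    ∃ Y : G →+ Additive Ωˣ, (∀ h : H, Y h = χ h) ∧ Y v ≠ r := by
  obtain ⟨Y, hY⟩ := char_extend Ω H χ
  by_cases hr : Y v = r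
  · obtain ⟨Z, hZ⟩ := char_sep Ω (QuotientAddGroup.mk v : G ⧸ H)
      (by rwa [Ne, QuotientAddGroup.eq_zero_iff])
    refine ⟨Y + Z.comp (QuotientAddGroup.mk' H), fun h => ?_, ?_⟩
    · have : (QuotientAddGroup.mk' H) (h : G) = 0 := (QuotientAddGroup.eq_zero_iff _).2 h.2
      rw [AddMonoidHom.add_apply, AddMonoidHom.comp_apply, this, map_zero, add_zero, hY]
    · rw [AddMonoidHom.add_apply, hr]
      intro h
      exact hZ (by simpa using h)
  · exact ⟨Y, hY, hr⟩

end chars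

section points

variable {K Ω : Type*} [Field K] [Field Ω] [Algebra K Ω]

open Classical in
/-- The point supported on `E` attached to a character. -/
noncomputable def pt (Y : (Fin m → ℤ) →+ Additive Ωˣ) (E : Set (Fin m)) : Fin m → Ω :=
  fun i => if i ∈ E then ((Additive.toMul (Y (Pi.single i 1)) : Ωˣ) : Ω) else 0

lemma char_eq (Y : (Fin m → ℤ) →+ Additive Ωˣ) (a : Fin m →₀ ℕ) :
    ((Additive.toMul (Y (fun i => (a i : ℤ))) : Ωˣ) : Ω) =
      ∏ i, ((Additive.toMul (Y (Pi.single i 1)) : Ωˣ) : Ω) ^ (a i) := by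
  classical
  have : (fun i => (a i : ℤ)) = ∑ i, a i • (Pi.single i (1 : ℤ) : Fin m → ℤ) := by
    funext k
    simp [Finset.sum_apply, Pi.single_apply]
  rw [this, map_sum]
  simp only [map_nsmul, toMul_sum, toMul_nsmul, Units.coe_prod, Units.val_pow_eq_pow_val]

lemma pt_mon (Y : (Fin m → ℤ) →+ Additive Ωˣ) (E : Set (Fin m)) (a : Fin m →₀ ℕ)
    (h : ∀ i ∉ E, a i = 0) :
    ∏ i, pt Y E i ^ (a i) = ((Additive.toMul (Y (fun i => (a i : ℤ))) : Ωˣ) : Ω) := by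
  rw [char_eq]
  refine Finset.prod_congr rfl fun i _ => ?_
  by_cases hi : i ∈ E
  · simp [pt, hi]
  · simp [h i hi]

lemma pt_mon_zero (Y : (Fin m → ℤ) →+ Additive Ωˣ) (E : Set (Fin m)) (a : Fin m →₀ ℕ)
    (h : ¬ ∀ i ∉ E, a i = 0) : ∏ i, pt Y E i ^ (a i) = 0 := by
  push Not at h
  obtain ⟨i, hi, hai⟩ := h
  exact Finset.prod_eq_zero (Finset.mem_univ i) (by simp [pt, hi, hai])

lemma aeval_mon (x : Fin m → Ω) (a : Fin m →₀ ℕ) (c : K) :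
    aeval x (monomial a c) = algebraMap K Ω c * ∏ i, x i ^ (a i) := by
  rw [aeval_monomial, Finsupp.prod_fintype _ _ (by simp)]

/-- image of the character value in `Ω` -/
noncomputable def rhoO (Ω : Type*) [Field Ω] [Algebra K Ω] {L : AddSubgroup (Fin m → ℤ)}
    (ρ : AddChar L Kˣ) : L →+ Additive Ωˣ where
  toFun v := Additive.ofMul (Units.map (algebraMap K Ω).toMonoidHom (ρ v))
  map_zero' := by simp
  map_add' a b := by rw [AddChar.map_add_eq_mul, map_mul]; rfl

lemma pp_iff (u : Fin m → ℤ) (E : Set (Fin m)) :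
    (∀ i ∉ E, pp u i = 0) ↔ ∀ i ∉ E, u i ≤ 0 := by
  refine forall₂_congr fun i _ => ?_
  simp [pp]

lemma np_iff (u : Fin m → ℤ) (E : Set (Fin m)) :
    (∀ i ∉ E, np u i = 0) ↔ ∀ i ∉ E, 0 ≤ u i := by
  refine forall₂_congr fun i _ => ?_
  simp [np]

lemma ppz_iff (u : Fin m → ℤ) (E : Set (Fin m)) : ppz u ∈ ZE E ↔ ∀ i ∉ E, u i ≤ 0 := by
  refine forall₂_congr fun i _ => ?_
  simp [ppz]

lemma npz_iff (u : Fin m → ℤ) (E : Set (Fin m)) : npz u ∈ ZE E ↔ ∀ i ∉ E, 0 ≤ u i := by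
  refine forall₂_congr fun i _ => ?_
  simp [npz]

lemma pt_zero_iff {L : AddSubgroup (Fin m → ℤ)} (ρ : AddChar L Kˣ)
    (Y : (Fin m → ℤ) →+ Additive Ωˣ) (E : Set (Fin m)) (u : L) :
    aeval (pt Y E) (Bpoly K ρ u) = 0 ↔
      ((∀ i ∉ E, (u : Fin m → ℤ) i ≤ 0) ↔ (∀ i ∉ E, 0 ≤ (u : Fin m → ℤ) i)) ∧
      ((u : Fin m → ℤ) ∈ ZE E → Y u = rhoO Ω ρ u) := by
  have hρ : algebraMap K Ω ((ρ u : Kˣ) : K) ≠ 0 := by simp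
  have hdec : (fun i => (pp (u : Fin m → ℤ) i : ℤ)) =
      (u : Fin m → ℤ) + (fun i => (np (u : Fin m → ℤ) i : ℤ)) := by
    funext i
    simp only [pp, np, Finsupp.equivFunOnFinite_symm_apply_apply, Pi.add_apply]
    omega
  rw [Bpoly, map_sub, aeval_mon, aeval_mon, map_one, one_mul, sub_eq_zero]
  by_cases hP : ∀ i ∉ E, (u : Fin m → ℤ) i ≤ 0
  · rw [pt_mon _ _ _ ((pp_iff _ _).2 hP)]
    by_cases hN : ∀ i ∉ E, 0 ≤ (u : Fin m → ℤ) i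
    · rw [pt_mon _ _ _ ((np_iff _ _).2 hN)]
      have hu : (u : Fin m → ℤ) ∈ ZE E := fun i hi => le_antisymm (hP i hi) (hN i hi)
      have hiff : (((∀ i ∉ E, (u : Fin m → ℤ) i ≤ 0) ↔ (∀ i ∉ E, 0 ≤ (u : Fin m → ℤ) i)) ∧
          ((u : Fin m → ℤ) ∈ ZE E → Y u = rhoO Ω ρ u)) ↔ Y u = rhoO Ω ρ u :=
        ⟨fun h => h.2 hu, fun h => ⟨⟨fun _ => hN, fun _ => hP⟩, fun _ => h⟩⟩
      rw [hiff]
      rw [hdec, map_add, toMul_add, Units.val_mul]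
      rw [mul_left_inj' (Units.ne_zero _)]
      constructor
      · intro h
        apply Additive.toMul.injective
        apply Units.ext
        exact h
      · intro h
        rw [h]
        rfl
    · rw [pt_mon_zero _ _ _ (fun h => hN ((np_iff _ _).1 h))]
      constructor
      · intro h
        simp at h
      · rintro ⟨h, -⟩
        exact absurd (h.1 hP) hN
  · rw [pt_mon_zero _ _ _ (fun h => hP ((pp_iff _ _).1 h))]
    by_cases hN : ∀ i ∉ E, 0 ≤ (u : Fin m → ℤ) i
    · rw [pt_mon _ _ _ ((np_iff _ _).2 hN)]
      constructor
      · intro h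
        rcases mul_eq_zero.1 h.symm with h | h
        · exact absurd h hρ
        · simp at h
      · rintro ⟨h, -⟩
        exact absurd (h.2 hN) hP
    · rw [pt_mon_zero _ _ _ (fun h => hN ((np_iff _ _).1 h)), mul_zero]
      refine ⟨fun _ => ⟨⟨fun h => absurd h hP, fun h => absurd h hN⟩, fun h => ?_⟩, fun _ => rfl⟩
      exact absurd (fun i hi => (h i hi).le) hP

/-- Every point is of the form `pt Y E`. -/
lemma exists_pt (x : Fin m → Ω) : ∃ Y : (Fin m → ℤ) →+ Additive Ωˣ, x = pt Y {i | x i ≠ 0} := by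
  classical
  let y : Fin m → Additive Ωˣ := fun i =>
    if h : x i ≠ 0 then Additive.ofMul (Units.mk0 (x i) h) else 0
  refine ⟨∑ i, (zmultiplesHom (Additive Ωˣ) (y i)).comp (Pi.evalAddMonoidHom _ i), ?_⟩
  funext i
  by_cases h : x i = 0
  · simp [pt, h]
  · have : (∑ k, (zmultiplesHom (Additive Ωˣ) (y k)).comp (Pi.evalAddMonoidHom _ k))
        (Pi.single i 1 : Fin m → ℤ) = y i := by
      rw [AddMonoidHom.finsetSum_apply, Finset.sum_eq_single i]
      · simp
      · intro k _ hk
        simp [hk]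
      · simp
    rw [pt, if_pos (show i ∈ {i | x i ≠ 0} from h), this]
    simp [y, h]

lemma mem_radical_of_points {J : Ideal (MvPolynomial (Fin m) K)} {f : MvPolynomial (Fin m) K}
    (h : ∀ (P : Ideal (MvPolynomial (Fin m) K)) [P.IsPrime] (x : Fin m → P.ResidueField),
      (∀ g ∈ J, aeval x g = 0) → aeval x f = 0) : f ∈ J.radical := by
  rw [Ideal.radical_eq_sInf, Submodule.mem_sInf]
  intro (P : Ideal (MvPolynomial (Fin m) K)) hPP
  obtain ⟨hJP, hP⟩ := hPP
  have : P.IsPrime := hP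
  have key : ∀ g : MvPolynomial (Fin m) K,
      aeval (fun i => algebraMap (MvPolynomial (Fin m) K) P.ResidueField (X i)) g =
      algebraMap _ P.ResidueField g := by
    intro g
    have := aeval_algebraMap_apply (R := K) P.ResidueField (X : Fin m → MvPolynomial (Fin m) K) g
    rw [aeval_X_left_apply] at this
    exact this
  have := h P (fun i => algebraMap _ _ (X i)) (fun g hg => by
    rw [key, Ideal.algebraMap_residueField_eq_zero]
    exact hJP hg)
  rwa [key, Ideal.algebraMap_residueField_eq_zero] at this

lemma aeval_eq_zero_of_radical {J : Ideal (MvPolynomial (Fin m) K)} {f : MvPolynomial (Fin m) K}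
    (hf : f ∈ J.radical) (x : Fin m → Ω) (h : ∀ g ∈ J, aeval x g = 0) : aeval x f = 0 := by
  obtain ⟨k, hk⟩ := hf
  have := h _ hk
  rw [map_pow] at this
  exact eq_zero_of_pow_eq_zero this

lemma aeval_span_zero {q : ℕ} (x : Fin m → Ω) (b : Fin q → MvPolynomial (Fin m) K)
    (h : ∀ i, aeval x (b i) = 0) : ∀ g ∈ Ideal.span (Set.range b), aeval x g = 0 := by
  have : Ideal.span (Set.range b) ≤ RingHom.ker (aeval x : MvPolynomial (Fin m) K →ₐ[K] Ω) := by
    rw [Ideal.span_le]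
    rintro _ ⟨i, rfl⟩
    exact h i
  exact fun g hg => this hg

end points
/-- Theorem 3.5, characteristic zero: the binomials `B(u₁),…,B(u_q)` generate
`rad I_{L,ρ}` up to radical iff they form a cover of `A` and for every face `F` of `σ_L`
the vectors `u_i` lying in `ℤ^{𝔼_F}` generate the lattice `L ∩ ℤ^{𝔼_F}`. -/
theorem statement4 {K : Type*} [Field K] [CharZero K] {m n : ℕ}
    (L : AddSubgroup (Fin m → ℤ)) (ρ : AddChar L Kˣ)
    (hL : L ≠ ⊥) (hpos : IsPositive L)
    (A : Fin m → Fin n → ℤ) (hA : IsConfig L A)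
    {q : ℕ} (u : Fin q → L) :
    (latIdeal K ρ).radical =
        (Ideal.span (Set.range fun i => Bpoly K ρ (u i))).radical ↔
      (IsCover A (fun i => (u i : Fin m → ℤ)) ∧
        ∀ F : Set (Fin n → ℚ), IsFace A F →
          L ⊓ ZE (EF A F) =
            AddSubgroup.closure
              {v : Fin m → ℤ | ∃ i, (u i : Fin m → ℤ) = v ∧ v ∈ ZE (EF A F)}) := by
  have hJI : Ideal.span (Set.range fun i => Bpoly K ρ (u i)) ≤ latIdeal K ρ := by
    rw [Ideal.span_le]
    rintro _ ⟨i, rfl⟩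
    exact Ideal.subset_span ⟨u i, Set.mem_univ _, rfl⟩
  have hred : (latIdeal K ρ).radical =
        (Ideal.span (Set.range fun i => Bpoly K ρ (u i))).radical ↔
      ∀ v : L, Bpoly K ρ v ∈ (Ideal.span (Set.range fun i => Bpoly K ρ (u i))).radical := by
    constructor
    · intro h v
      rw [← h]
      exact Ideal.le_radical (Ideal.subset_span ⟨v, Set.mem_univ _, rfl⟩)
    · intro h
      apply le_antisymm
      · rw [Ideal.radical_le_radical_iff, latIdeal, latIdealOn, Ideal.span_le]
        rintro _ ⟨v, -, rfl⟩
        exact h v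
      · exact Ideal.radical_mono hJI
  rw [hred]
  constructor
  · intro h
    -- a point killing the generators kills all binomials
    have hpt : ∀ (Y : (Fin m → ℤ) →+ Additive (AlgebraicClosure K)ˣ) (E : Set (Fin m)),
        (∀ i, aeval (pt Y E) (Bpoly K ρ (u i)) = 0) →
        ∀ v : L, aeval (pt Y E) (Bpoly K ρ v) = 0 := fun Y E hz v =>
      aeval_eq_zero_of_radical (h v) _ (aeval_span_zero _ _ hz)
    have : CharZero (AlgebraicClosure K) :=
      charZero_of_injective_algebraMap (algebraMap K (AlgebraicClosure K)).injective
    refine ⟨fun E hE => ?_, fun F hF => ?_⟩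
    · by_contra hcon
      obtain ⟨Y, hY⟩ := char_extend (AlgebraicClosure K) L (rhoO (AlgebraicClosure K) ρ)
      obtain ⟨v, hvL, hN, hP⟩ := not_face_exists L A hA E hE
      have := hpt Y E (fun i => by
        rw [pt_zero_iff]
        refine ⟨?_, fun _ => hY _⟩
        rw [← ppz_iff, ← npz_iff]
        by_contra hne
        apply hcon
        refine ⟨i, ?_⟩
        tauto) ⟨v, hvL⟩
      rw [pt_zero_iff] at this
      exact hP (this.1.2 hN)
    · apply le_antisymm
      · rintro v ⟨hvL, hvE⟩
        by_contra hv
        have hle : AddSubgroup.closure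
            {v : Fin m → ℤ | ∃ i, (u i : Fin m → ℤ) = v ∧ v ∈ ZE (EF A F)} ≤ L := by
          rw [AddSubgroup.closure_le]
          rintro _ ⟨i, rfl, -⟩
          exact (u i).2
        obtain ⟨Y, hY, hYv⟩ := char_extend_avoid (AlgebraicClosure K) _
          ((rhoO (AlgebraicClosure K) ρ).comp (AddSubgroup.inclusion hle)) v hv
          (rhoO (AlgebraicClosure K) ρ ⟨v, hvL⟩)
        have := hpt Y (EF A F) (fun i => by
          rw [pt_zero_iff]
          refine ⟨?_, fun hi => ?_⟩
          · have := face_sym L A hA F hF (u i) (u i).2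
            rw [this.1, this.2]
          · exact hY ⟨u i, AddSubgroup.subset_closure ⟨i, rfl, hi⟩⟩) ⟨v, hvL⟩
        rw [pt_zero_iff] at this
        exact hYv (this.2 hvE)
      · rw [AddSubgroup.closure_le]
        rintro _ ⟨i, rfl, hi⟩
        exact ⟨(u i).2, hi⟩
  · rintro ⟨hcov, hgen⟩ v
    apply mem_radical_of_points
    intro P _ x hx
    obtain ⟨Y, hY⟩ := exists_pt x
    have hz : ∀ i, aeval x (Bpoly K ρ (u i)) = 0 := fun i =>
      hx _ (Ideal.subset_span ⟨i, rfl⟩)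
    generalize {i | x i ≠ 0} = E at hY
    subst hY
    have hz' := fun i => (pt_zero_iff ρ Y E (u i)).1 (hz i)
    by_cases hE : ∀ F, IsFace A F → E ≠ EF A F
    · obtain ⟨i, hi⟩ := hcov E hE
      have := (hz' i).1
      rw [← ppz_iff, ← npz_iff] at this
      tauto
    · push Not at hE
      obtain ⟨F, hF, rfl⟩ := hE
      rw [pt_zero_iff]
      have hs := face_sym L A hA F hF v v.2
      refine ⟨by rw [hs.1, hs.2], fun hv => ?_⟩
      have hmem : (v : Fin m → ℤ) ∈ L ⊓ ZE (EF A F) := ⟨v.2, hv⟩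
      rw [hgen F hF] at hmem
      have key : ∀ w ∈ AddSubgroup.closure
          {v : Fin m → ℤ | ∃ i, (u i : Fin m → ℤ) = v ∧ v ∈ ZE (EF A F)},
          ∃ hw : w ∈ L, Y w = rhoO P.ResidueField ρ ⟨w, hw⟩ := by
        intro w hw
        induction hw using AddSubgroup.closure_induction with
        | mem w hw =>
          obtain ⟨i, rfl, hi⟩ := hw
          exact ⟨(u i).2, (hz' i).2 hi⟩
        | zero =>
          refine ⟨L.zero_mem, ?_⟩
          rw [map_zero]
          exact (map_zero _).symm
        | add a b _ _ ha hb =>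
          obtain ⟨ha, ha'⟩ := ha
          obtain ⟨hb, hb'⟩ := hb
          refine ⟨L.add_mem ha hb, ?_⟩
          rw [map_add, ha', hb', ← map_add]
          rfl
        | neg a _ ha =>
          obtain ⟨ha, ha'⟩ := ha
          refine ⟨L.neg_mem ha, ?_⟩
          rw [map_neg, ha', ← map_neg]
          rfl
      obtain ⟨_, h⟩ := key v hmem
      exact h

end LatticePaper
end

section
/- Let K be a field and (L,ρ) a partial character on ℤ^m with L nonzero and positive, such that the rational polyhedral cone σ_L = pos_ℚ(A) ⊂ ℚ^n associated to I_{L,ρ} is a simplex cone of dimension n. Then there exists a cover of A consisting of m − n binomials of I_{L,ρ}. -/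
open MvPolynomial

namespace LatticePaper

/-- Every nonempty zero set of a nonnegative functional contains one along a single ray. -/
lemma exists_ray_functional {m n : ℕ} (a : Fin m → Fin n → ℚ) (h : (Fin n → ℚ) →ₗ[ℚ] ℚ)
    (hh : ∀ i, 0 < h (a i)) : ∀ (N : ℕ) (c : (Fin n → ℚ) →ₗ[ℚ] ℚ), (∀ i, 0 ≤ c (a i)) →
    (∃ i, c (a i) = 0) → (Finset.univ.filter fun i => c (a i) = 0).card ≤ N →
    ∃ c' : (Fin n → ℚ) →ₗ[ℚ] ℚ, (∀ i, 0 ≤ c' (a i)) ∧ (∃ i, c' (a i) = 0) ∧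
      (∀ i, c' (a i) = 0 → c (a i) = 0) ∧
      (∀ i j, c' (a i) = 0 → c' (a j) = 0 → a j = (h (a j) / h (a i)) • a i) := by
  intro N
  induction N with
  | zero =>
    intro c _ ⟨i, hi⟩ hcard
    have : i ∈ (Finset.univ.filter fun i => c (a i) = 0) := by simp [hi]
    have := Finset.card_pos.mpr ⟨i, this⟩
    omega
  | succ N ih =>
    intro c hc hne hcard
    by_cases hpar : ∀ i j, c (a i) = 0 → c (a j) = 0 → a j = (h (a j) / h (a i)) • a i
    · exact ⟨c, hc, hne, fun _ => id, hpar⟩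
    push Not at hpar
    obtain ⟨i, j, hi, hj, hij⟩ := hpar
    obtain ⟨k, hk⟩ := Function.ne_iff.mp hij
    let d : (Fin n → ℚ) →ₗ[ℚ] ℚ := LinearMap.proj k
    have hd : d (a j) / h (a j) ≠ d (a i) / h (a i) := by
      intro he
      apply hk
      have h1 := (hh i).ne'
      have h2 := (hh j).ne'
      simp only [d, LinearMap.proj_apply] at he
      simp only [Pi.smul_apply, smul_eq_mul]
      field_simp at he ⊢
      linarith
    let Z := Finset.univ.filter fun i => c (a i) = 0
    have hZ : Z.Nonempty := ⟨i, by simp [Z, hi]⟩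
    obtain ⟨p, hpZ, hp⟩ := Finset.exists_min_image Z (fun i => d (a i) / h (a i)) hZ
    let μ := d (a p) / h (a p)
    let d' := d - μ • h
    have hd'eq : ∀ i, d' (a i) = (d (a i) / h (a i) - μ) * h (a i) := by
      intro i
      have := (hh i).ne'
      simp only [d', LinearMap.sub_apply, LinearMap.smul_apply, smul_eq_mul]
      field_simp
    have hd'0 : ∀ i, c (a i) = 0 → 0 ≤ d' (a i) := by
      intro i hi
      rw [hd'eq]
      have := hp i (by simp [Z, hi])
      exact mul_nonneg (by simp only [μ]; linarith) (hh i).le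
    have hpc : c (a p) = 0 := by simpa [Z] using hpZ
    have hd'p : d' (a p) = 0 := by rw [hd'eq]; simp [μ]
    obtain ⟨q, hq, hqne⟩ : ∃ q, c (a q) = 0 ∧ d' (a q) ≠ 0 := by
      by_contra hcon
      push Not at hcon
      have h1 := hcon i hi
      have h2 := hcon j hj
      rw [hd'eq] at h1 h2
      have h3 := (mul_eq_zero.mp h1).resolve_right (hh i).ne'
      have h4 := (mul_eq_zero.mp h2).resolve_right (hh j).ne'
      apply hd
      linarith
    let M : ℚ := 1 + ∑ i, |d' (a i)| / c (a i)
    have hM : ∀ i, 0 < c (a i) → 0 < M * c (a i) + d' (a i) := by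
      intro i hi
      have h1 : |d' (a i)| / c (a i) ≤ ∑ i, |d' (a i)| / c (a i) :=
        Finset.single_le_sum (f := fun i => |d' (a i)| / c (a i))
          (fun i _ => div_nonneg (abs_nonneg _) (hc i)) (Finset.mem_univ i)
      have h2 : (1 + |d' (a i)| / c (a i)) * c (a i) ≤ M * c (a i) :=
        mul_le_mul_of_nonneg_right (by simp only [M]; linarith) hi.le
      have h3 : (1 + |d' (a i)| / c (a i)) * c (a i) = c (a i) + |d' (a i)| := by
        field_simp
      have := neg_abs_le (d' (a i))
      linarith
    let c2 := M • c + d'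
    have hc2eq : ∀ i, c2 (a i) = M * c (a i) + d' (a i) := fun i => by simp [c2]
    have hc2z : ∀ i, c2 (a i) = 0 → c (a i) = 0 := by
      intro i hi
      by_contra hne
      have := hM i (lt_of_le_of_ne (hc i) (Ne.symm hne))
      rw [hc2eq] at hi
      linarith
    obtain ⟨c', h1, h2, h3, h4⟩ := ih c2
      (by
        intro i
        rw [hc2eq]
        rcases (hc i).eq_or_lt with h0 | h0
        · rw [← h0]; simpa using hd'0 i h0.symm
        · exact (hM i h0).le)
      ⟨p, by rw [hc2eq, hpc, hd'p]; simp⟩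
      (by
        have : (Finset.univ.filter fun i => c2 (a i) = 0).card < Z.card := by
          apply Finset.card_lt_card
          rw [Finset.ssubset_iff_of_subset]
          · refine ⟨q, by simp [Z, hq], ?_⟩
            simp only [Finset.mem_filter, Finset.mem_univ, true_and]
            rw [hc2eq, hq]
            simpa using hqne
          · intro i hi
            simp only [Finset.mem_filter, Finset.mem_univ, true_and, Z] at hi ⊢
            exact hc2z i hi
        have h5 : Z.card ≤ N + 1 := hcard
        omega)
    exact ⟨c', h1, h2, fun i hi => hc2z i (h3 i hi), h4⟩

lemma mem_cone {m n : ℕ} (A : Fin m → Fin n → ℤ) (i : Fin m) : ratA A i ∈ cone A := by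
  refine ⟨Pi.single i 1, ?_, ?_⟩
  · intro j
    by_cases h : j = i
    · subst h; simp
    · simp [h]
  · simp [Pi.single_apply]

lemma dual_eq {n : ℕ} (φ : (Fin n → ℚ) →ₗ[ℚ] ℚ) (x : Fin n → ℚ) :
    φ x = ∑ j, φ (Pi.single j 1) * x j := by
  conv_lhs => rw [← Finset.univ_sum_single x]
  rw [map_sum]
  refine Finset.sum_congr rfl fun j _ => ?_
  have : (Pi.single j (x j) : Fin n → ℚ) = x j • Pi.single j 1 := by
    rw [← Pi.single_smul]; simp
  rw [this, map_smul, smul_eq_mul, mul_comm]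

lemma nonneg_cone {m n : ℕ} (A : Fin m → Fin n → ℤ) (φ : (Fin n → ℚ) →ₗ[ℚ] ℚ)
    (h : ∀ i, 0 ≤ φ (ratA A i)) : ∀ x ∈ cone A, 0 ≤ φ x := by
  rintro x ⟨lam, hl, rfl⟩
  simp only [map_sum, map_smul, smul_eq_mul]
  exact Finset.sum_nonneg fun i _ => mul_nonneg (hl i) (h i)

lemma isFace_of_s6 {m n : ℕ} (A : Fin m → Fin n → ℤ) (φ : (Fin n → ℚ) →ₗ[ℚ] ℚ)
    (h : ∀ i, 0 ≤ φ (ratA A i)) : IsFace A (cone A ∩ {x | φ x = 0}) := by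
  refine ⟨fun j => φ (Pi.single j 1), ?_, ?_⟩
  · intro x hx
    rw [← dual_eq]
    exact nonneg_cone A φ h x hx
  · ext x
    simp [dual_eq φ x]

lemma face_functional {m n : ℕ} (A : Fin m → Fin n → ℤ) (F : Set (Fin n → ℚ)) (hF : IsFace A F) :
    ∃ φ : (Fin n → ℚ) →ₗ[ℚ] ℚ, (∀ x ∈ cone A, 0 ≤ φ x) ∧ F = cone A ∩ {x | φ x = 0} := by
  obtain ⟨c, h1, h2⟩ := hF
  exact ⟨∑ j, c j • LinearMap.proj j, by simpa using h1, by simpa using h2⟩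

/-- The cone is generated by the given rays. -/
lemma coord_nonneg {m n : ℕ} (A : Fin m → Fin n → ℤ) (hne : ∀ i, ratA A i ≠ 0)
    (b : Module.Basis (Fin n) ℚ (Fin n → ℚ))
    (hvface : ∀ i, IsFace A {x : Fin n → ℚ | ∃ t : ℚ, 0 ≤ t ∧ x = t • b i})
    (hrays : ∀ F : Set (Fin n → ℚ), IsFace A F →
      Module.rank ℚ ↥(Submodule.span ℚ F) = 1 →
      ∃ i, F = {x : Fin n → ℚ | ∃ t : ℚ, 0 ≤ t ∧ x = t • b i})
    (i : Fin m) (k : Fin n) : 0 ≤ b.coord k (ratA A i) := by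
  choose c hc hF using fun i => face_functional A _ (hvface i)
  have hmem : ∀ i, b i ∈ cone A ∩ {x | c i x = 0} := by
    intro i
    rw [← hF i]
    exact ⟨1, by norm_num, by simp⟩
  have hbne : ∀ i, b i ≠ 0 := b.ne_zero
  by_cases hk : ∃ k', k' ≠ k
  · obtain ⟨k', hk'⟩ := hk
    let h : (Fin n → ℚ) →ₗ[ℚ] ℚ := c k + c k'
    have hpos : ∀ x ∈ cone A, x ≠ 0 → 0 < h x := by
      intro x hx hx0
      have h1 := hc k x hx
      have h2 := hc k' x hx
      rcases (add_nonneg h1 h2).eq_or_lt with h0 | h0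
      · exfalso
        have e1 : x ∈ {x : Fin n → ℚ | ∃ t : ℚ, 0 ≤ t ∧ x = t • b k} := by
          rw [hF k]; exact ⟨hx, by simp only [Set.mem_ofPred_eq]; linarith⟩
        have e2 : x ∈ {x : Fin n → ℚ | ∃ t : ℚ, 0 ≤ t ∧ x = t • b k'} := by
          rw [hF k']; exact ⟨hx, by simp only [Set.mem_ofPred_eq]; linarith⟩
        obtain ⟨t, _, ht⟩ := e1
        obtain ⟨s, _, hs⟩ := e2
        have h3 : b.coord k x = t := by rw [ht]; simp
        have h4 : b.coord k x = 0 := by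
          rw [hs]; simp [Finsupp.single_apply, hk']
        rw [h3] at h4
        rw [h4] at ht
        simp at ht
        exact hx0 ht
      · exact h0
    have hh : ∀ i, 0 < h (ratA A i) := fun i => hpos _ (mem_cone A i) (hne i)
    by_contra hcon
    push Not at hcon
    obtain ⟨p, _, hp⟩ := Finset.exists_min_image Finset.univ
      (fun i => b.coord k (ratA A i) / h (ratA A i)) ⟨i, Finset.mem_univ i⟩
    let μ := b.coord k (ratA A p) / h (ratA A p)
    have hμ : μ < 0 :=
      lt_of_le_of_lt (hp i (Finset.mem_univ i)) (div_neg_of_neg_of_pos hcon (hh i))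
    let c0 : (Fin n → ℚ) →ₗ[ℚ] ℚ := b.coord k - μ • h
    have hc0 : ∀ i, c0 (ratA A i) = (b.coord k (ratA A i) / h (ratA A i) - μ) * h (ratA A i) := by
      intro i
      have := (hh i).ne'
      simp only [c0, LinearMap.sub_apply, LinearMap.smul_apply, smul_eq_mul]
      field_simp
    obtain ⟨c', h1, ⟨i0, h2⟩, h3, h4⟩ := exists_ray_functional (ratA A) h hh _ c0
      (by
        intro i
        rw [hc0]
        have := hp i (Finset.mem_univ i)
        exact mul_nonneg (by simp only [μ]; linarith) (hh i).le)
      ⟨p, by rw [hc0]; simp [μ]⟩ le_rfl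
    have hspan : Submodule.span ℚ (cone A ∩ {x | c' x = 0}) = Submodule.span ℚ {ratA A i0} := by
      apply le_antisymm
      · rw [Submodule.span_le]
        rintro x ⟨⟨lam, hl, rfl⟩, hx⟩
        simp only [Set.mem_ofPred_eq, map_sum, map_smul, smul_eq_mul] at hx
        rw [Finset.sum_eq_zero_iff_of_nonneg
          (fun i _ => mul_nonneg (hl i) (h1 i))] at hx
        refine Submodule.sum_mem _ fun j _ => ?_
        rcases mul_eq_zero.mp (hx j (Finset.mem_univ j)) with h0 | h0
        · rw [h0]; simp
        · rw [h4 i0 j h2 h0]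
          exact Submodule.smul_mem _ _ (Submodule.smul_mem _ _ (Submodule.mem_span_singleton_self _))
      · apply Submodule.span_mono
        rintro x rfl
        exact ⟨mem_cone A i0, h2⟩
    obtain ⟨l, hl⟩ := hrays _ (isFace_of_s6 A c' h1) (by
      rw [hspan, rank_submodule_eq_one_iff]
      exact ⟨ratA A i0, Submodule.mem_span_singleton_self _, hne i0, le_rfl⟩)
    have hi0 : ratA A i0 ∈ cone A ∩ {x | c' x = 0} := ⟨mem_cone A i0, h2⟩
    rw [hl] at hi0
    obtain ⟨t, ht, hti⟩ := hi0
    have h5 := h3 i0 h2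
    simp only [c0, LinearMap.sub_apply, LinearMap.smul_apply, smul_eq_mul] at h5
    have h6 : 0 ≤ b.coord k (ratA A i0) := by
      rw [hti]
      simp only [map_smul, smul_eq_mul, Module.Basis.coord_apply, Module.Basis.repr_self]
      apply mul_nonneg ht
      rw [Finsupp.single_apply]; split_ifs <;> norm_num
    have h7 := mul_neg_of_neg_of_pos hμ (hh i0)
    linarith
  · push Not at hk
    have hcz : c k = 0 := by
      apply b.ext
      intro j
      rw [hk j]
      simpa using (hmem k).2
    have : ratA A i ∈ cone A ∩ {x | c k x = 0} := ⟨mem_cone A i, by simp [hcz]⟩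
    rw [← hF k] at this
    obtain ⟨t, ht, hti⟩ := this
    rw [hti]
    simpa using ht

/-- On each ray there is one of the vectors of `A`. -/
lemma exists_on_ray {m n : ℕ} (A : Fin m → Fin n → ℤ) (hne : ∀ i, ratA A i ≠ 0)
    (w : Fin n → ℚ) (hw : w ≠ 0)
    (hface : IsFace A {x : Fin n → ℚ | ∃ t : ℚ, 0 ≤ t ∧ x = t • w}) :
    ∃ j, ∃ t : ℚ, 0 < t ∧ ratA A j = t • w := by
  obtain ⟨c, hc, hF⟩ := face_functional A _ hface
  have hmem : w ∈ cone A ∩ {x | c x = 0} := by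
    rw [← hF]
    exact ⟨1, by norm_num, by simp⟩
  obtain ⟨⟨lam, hl, hlw⟩, hx⟩ := hmem
  rw [hlw] at hx
  simp only [Set.mem_ofPred_eq, map_sum, map_smul, smul_eq_mul] at hx
  rw [Finset.sum_eq_zero_iff_of_nonneg
    (fun i _ => mul_nonneg (hl i) (hc _ (mem_cone A i)))] at hx
  obtain ⟨j, _, hj⟩ := Finset.exists_ne_zero_of_sum_ne_zero (hlw ▸ hw)
  have hlj : lam j ≠ 0 := fun h0 => hj (by rw [h0]; simp)
  have hcj : c (ratA A j) = 0 := (mul_eq_zero.mp (hx j (Finset.mem_univ j))).resolve_left hlj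
  have : ratA A j ∈ cone A ∩ {x | c x = 0} := ⟨mem_cone A j, hcj⟩
  rw [← hF] at this
  obtain ⟨t, ht, htj⟩ := this
  refine ⟨j, t, lt_of_le_of_ne ht ?_, htj⟩
  rintro rfl
  exact hne j (by rw [htj]; simp)

/-- Clearing denominators of a finite family of rationals. -/
lemma exists_common_den {n : ℕ} (q : Fin n → ℚ) :
    ∃ (N : ℤ) (p : Fin n → ℤ), 0 < N ∧ ∀ k, (p k : ℚ) = N * q k := by
  refine ⟨∏ k, ((q k).den : ℤ), fun k => (∏ j ∈ Finset.univ.erase k, ((q j).den : ℤ)) * (q k).num,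
    Finset.prod_pos fun k _ => by exact_mod_cast (q k).den_pos, fun k => ?_⟩
  rw [← Finset.prod_erase_mul _ _ (Finset.mem_univ k)]
  push_cast
  rw [mul_assoc, Rat.den_mul_eq_num]

/-- The lattice vector attached to a non-extreme vector of the configuration. -/
lemma exists_lattice_vector {m n : ℕ} (L : AddSubgroup (Fin m → ℤ))
    (A : Fin m → Fin n → ℤ) (hA : IsConfig L A)
    (f : Fin n → Fin m) (hf : Function.Injective f) (j : Fin m) (hj : j ∉ Set.range f)
    (lam : Fin n → ℚ) (hlam : ∀ k, 0 ≤ lam k)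
    (hsum : ratA A j = ∑ k, lam k • ratA A (f k)) :
    ∃ u : L, 0 < u.1 j ∧ (∀ k, u.1 (f k) ≤ 0 ∧ (u.1 (f k) = 0 ↔ lam k = 0)) ∧
      ∀ i, i ≠ j → i ∉ Set.range f → u.1 i = 0 := by
  classical
  obtain ⟨N, p, hN, hp⟩ := exists_common_den lam
  let u : Fin m → ℤ := Pi.single j N - ∑ k, Pi.single (f k) (p k)
  have hNq : (0 : ℚ) < N := by exact_mod_cast hN
  have huj : u j = N := by
    have : ∀ k, j ≠ f k := fun k hk => hj ⟨k, hk.symm⟩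
    simp [u, Finset.sum_apply, Pi.single_apply, this]
  have huf : ∀ k, u (f k) = - p k := by
    intro k
    have : f k ≠ j := fun hk => hj ⟨k, hk⟩
    simp [u, Finset.sum_apply, Pi.single_apply, this, hf.eq_iff]
  have hu0 : ∀ i, i ≠ j → i ∉ Set.range f → u i = 0 := by
    intro i hi hi'
    have : ∀ k, i ≠ f k := fun k hk => hi' ⟨k, hk.symm⟩
    simp [u, Finset.sum_apply, Pi.single_apply, this, hi]
  have hsm : ∀ (x : Fin m) (t : ℤ), ∑ i, (Pi.single x t : Fin m → ℤ) i • A i = t • A x := by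
    intro x t
    simp [Pi.single_apply, ite_smul]
  have hker : ∑ i, u i • A i = 0 := by
    have h1 : ∑ i, u i • A i = N • A j - ∑ k, p k • A (f k) := by
      simp only [u, Pi.sub_apply, sub_smul, Finset.sum_sub_distrib, hsm, Finset.sum_apply,
        Finset.sum_smul]
      rw [Finset.sum_comm]
      simp only [hsm]
    rw [h1]
    ext l
    have h2 := congrFun hsum l
    simp only [ratA, Finset.sum_apply, Pi.smul_apply, smul_eq_mul] at h2
    simp only [Pi.sub_apply, Pi.smul_apply, Finset.sum_apply, smul_eq_mul, Pi.zero_apply]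
    have : ((N * A j l - ∑ k, p k * A (f k) l : ℤ) : ℚ) = 0 := by
      push_cast
      rw [h2, Finset.mul_sum, sub_eq_zero]
      refine Finset.sum_congr rfl fun k _ => ?_
      rw [hp k]; ring
    exact_mod_cast this
  obtain ⟨d, hd, hdu⟩ := (hA.1 u).mp hker
  have hd2 : 0 < d * d := mul_self_pos.mpr hd
  refine ⟨⟨d • d • u, L.zsmul_mem hdu d⟩, ?_, ?_, ?_⟩
  · simp only [Pi.smul_apply, smul_eq_mul, huj]
    rw [← mul_assoc]
    exact mul_pos hd2 hN
  · intro k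
    have hpk : 0 ≤ p k := by
      have : (0 : ℚ) ≤ p k := by rw [hp k]; exact mul_nonneg hNq.le (hlam k)
      exact_mod_cast this
    simp only [Pi.smul_apply, smul_eq_mul, huf]
    constructor
    · rw [← mul_assoc]
      nlinarith
    · have : (p k = 0 ↔ lam k = 0) := by
        rw [← Int.cast_eq_zero (α := ℚ), hp k]
        simp [hN.ne']
      simp [hd, this]
  · intro i hi hi'
    simp [hu0 i hi hi']

/-- Proposition 3.6: if `σ_L ⊂ ℚ^n` is a simplex cone of dimension `n`
(its extreme rays are given by `n` linearly independent vectors), then there exists a cover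
of `A` consisting of `m - n` binomials `B(u)` with `u ∈ L`. -/
theorem statement6 {K : Type*} [Field K] {m n : ℕ}
    (L : AddSubgroup (Fin m → ℤ)) (ρ : AddChar L Kˣ)
    (hL : L ≠ ⊥) (hpos : IsPositive L)
    (A : Fin m → Fin n → ℤ) (hA : IsConfig L A)
    (v : Fin n → Fin n → ℚ)
    (hvli : LinearIndependent ℚ v)
    (hvface : ∀ i, IsFace A {x : Fin n → ℚ | ∃ t : ℚ, 0 ≤ t ∧ x = t • v i})
    (hrays : ∀ F : Set (Fin n → ℚ), IsFace A F →
      Module.rank ℚ ↥(Submodule.span ℚ F) = 1 →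
      ∃ i, F = {x : Fin n → ℚ | ∃ t : ℚ, 0 ≤ t ∧ x = t • v i}) :
    ∃ u : Fin (m - n) → L, IsCover A fun i => (u i : Fin m → ℤ) := by
  classical
  have hne : ∀ i, ratA A i ≠ 0 := by
    intro i hi
    have hAi : A i = 0 := by
      ext l
      have := congrFun hi l
      simpa [ratA] using this
    obtain ⟨d, hd, hdL⟩ := (hA.1 (Pi.single i 1)).mp (by simp [Pi.single_apply, hAi])
    have h1 := hpos _ (L.zsmul_mem hdL d) (by
      intro j
      by_cases hj : j = i
      · subst hj
        simpa using mul_self_nonneg d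
      · simp [hj])
    have h2 := congrFun h1 i
    simp [hd] at h2
  let b : Module.Basis (Fin n) ℚ (Fin n → ℚ) :=
    basisOfLinearIndependentOfCardEqFinrank' v hvli (by simp)
  have hb : ∀ i, b i = v i := fun i => by simp [b]
  simp only [← hb] at hvface hrays
  have hco := coord_nonneg A hne b hvface hrays
  choose f t ht hft using fun k => exists_on_ray A hne (b k) (b.ne_zero k) (hvface k)
  have hcf : ∀ k l, b.coord l (ratA A (f k)) = if k = l then t k else 0 := by
    intro k l
    rw [hft k]
    simp [Finsupp.single_apply]
  have hf : Function.Injective f := by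
    intro k l hkl
    by_contra hne'
    have h1 := hcf k k
    rw [hkl, hcf l k, if_neg (Ne.symm hne'), if_pos rfl] at h1
    exact (ht k).ne h1
  have hU : ∀ j : {j // j ∉ Set.range f}, ∃ u : L, 0 < u.1 j ∧
      (∀ k, u.1 (f k) ≤ 0 ∧ (u.1 (f k) = 0 ↔ b.coord k (ratA A j) = 0)) ∧
      ∀ i, i ≠ j.1 → i ∉ Set.range f → u.1 i = 0 := by
    rintro ⟨j, hj⟩
    obtain ⟨u, h1, h2, h3⟩ := exists_lattice_vector L A hA f hf j hj
      (fun k => b.coord k (ratA A j) / t k) (fun k => div_nonneg (hco j k) (ht k).le) (by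
        conv_lhs => rw [← b.sum_repr (ratA A j)]
        refine Finset.sum_congr rfl fun k _ => ?_
        rw [hft k, smul_smul, div_mul_cancel₀ _ (ht k).ne', Module.Basis.coord_apply])
    refine ⟨u, h1, fun k => ⟨(h2 k).1, (h2 k).2.trans ?_⟩, h3⟩
    simp [(ht k).ne']
  choose U hU1 hU2 hU3 using hU
  have hcard : Fintype.card {j // j ∉ Set.range f} = Fintype.card (Fin (m - n)) := by
    rw [Fintype.card_subtype_compl, Fintype.card_fin, Fintype.card_fin]
    have : Fintype.card {j // j ∈ Set.range f} = n := by
      rw [Fintype.card_congr (Equiv.ofInjective f hf).symm, Fintype.card_fin]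
    rw [this]
  let e := Fintype.equivOfCardEq hcard
  refine ⟨fun i => U (e.symm i), ?_⟩
  intro E hE
  let c : (Fin n → ℚ) →ₗ[ℚ] ℚ := ∑ k ∈ Finset.univ.filter (fun k => f k ∉ E), b.coord k
  have hcA : ∀ i, c (ratA A i) = ∑ k ∈ Finset.univ.filter (fun k => f k ∉ E),
      b.coord k (ratA A i) := fun i => by simp [c]
  have hEF : EF A (cone A ∩ {x | c x = 0}) =
      {j | ∀ k, f k ∉ E → b.coord k (ratA A j) = 0} := by
    ext j
    simp only [EF, Set.mem_ofPred_eq, Set.mem_inter_iff, mem_cone A j, true_and]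
    rw [hcA, Finset.sum_eq_zero_iff_of_nonneg (fun k _ => hco j k)]
    simp only [Finset.mem_filter, Finset.mem_univ, true_and]
  have hne' := hE _ (isFace_of_s6 A c (fun i => by
    rw [hcA]; exact Finset.sum_nonneg fun k _ => hco i k))
  rw [hEF] at hne'
  obtain ⟨j, hj⟩ : ∃ j, ¬ (j ∈ E ↔ ∀ k, f k ∉ E → b.coord k (ratA A j) = 0) := by
    by_contra hcon
    push Not at hcon
    exact hne' (Set.ext hcon)
  have hjr : j ∉ Set.range f := by
    rintro ⟨k, rfl⟩
    apply hj
    constructor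
    · intro hk l hl
      rw [hcf, if_neg]
      rintro rfl
      exact hl hk
    · intro h
      by_contra hk
      have := h k hk
      rw [hcf, if_pos rfl] at this
      exact (ht k).ne' this
  let J : {j // j ∉ Set.range f} := ⟨j, hjr⟩
  have hp1 : ppz (U J).1 ∈ ZE E ↔ j ∈ E := by
    constructor
    · intro h
      by_contra hjE
      have h1 : max ((U J).1 j) 0 = 0 := h j hjE
      have h2 : 0 < (U J).1 j := hU1 J
      omega
    · intro hjE i hi
      have hij : i ≠ j := fun h => hi (h ▸ hjE)
      show max ((U J).1 i) 0 = 0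
      by_cases hir : i ∈ Set.range f
      · obtain ⟨k, rfl⟩ := hir
        exact max_eq_right (hU2 J k).1
      · rw [hU3 J i hij hir]; rfl
  have hn1 : npz (U J).1 ∈ ZE E ↔ ∀ k, f k ∉ E → b.coord k (ratA A j) = 0 := by
    constructor
    · intro h k hk
      have h1 : max (-(U J).1 (f k)) 0 = 0 := h (f k) hk
      have h2 := (hU2 J k).1
      exact (hU2 J k).2.mp (by omega)
    · intro h i hi
      show max (-(U J).1 i) 0 = 0
      by_cases hir : i ∈ Set.range f
      · obtain ⟨k, rfl⟩ := hir
        rw [(hU2 J k).2.mpr (h k hi)]; rfl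
      · by_cases hij : i = j
        · have h2 : 0 < (U J).1 j := hU1 J
          rw [hij]; omega
        · rw [hU3 J i hij hir]; rfl
  refine ⟨e J, ?_⟩
  simp only [Equiv.symm_apply_apply]
  rw [hp1, hn1]
  tauto

end LatticePaper
end
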